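/- The fine-grained contract pricing problem is NP-hard: for any instance of 0-1 Knapsack with n items of values vᵢ ≥ 0, weights wᵢ ≥ 0, capacity W, and v₀ = maxᵢ vᵢ, construct a chain of n subtasks where subtask i has two configuration options with deterministic (time, cost) equal to (wᵢ, v₀ − vᵢ) or (0, v₀), and profit function P(T, C) = n·v₀ − C if T ≤ W and 0 if T > W (total time T is the sum of chosen times, total cost C the sum of chosen costs). Then the knapsack instance admits a selection of items with total weight ≤ W and total value V if and only if the pricing instance admits a configuration assignment with profit P = V (assuming V > 0). -/

import Mathlib

/-- The slack `n * v₀ - C` of a configuration is the total value of the items it selects. -/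
lemma card_mul_sub_sum_ite {n : ℕ} (v : Fin n → ℝ) (v₀ : ℝ) (choice : Fin n → Bool) :
    (n : ℝ) * v₀ - (∑ i, if choice i then v₀ - v i else v₀) =
      ∑ i, if choice i then v i else 0 := by
  have h : (n : ℝ) * v₀ = ∑ _i : Fin n, v₀ := by simp
  rw [h, ← Finset.sum_sub_distrib]
  refine Finset.sum_congr rfl fun i _ => ?_
  split_ifs <;> ring

open Classical in
/-- Correctness of the Knapsack reduction for fine-grained contract pricing. -/
theorem stmt13 {n : ℕ} (v w : Fin n → ℝ) (W v₀ V : ℝ)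
    (hv : ∀ i, 0 ≤ v i) (hw : ∀ i, 0 ≤ w i)
    (hv₀ : ∀ i, v i ≤ v₀) (hv₀mem : n = 0 ∨ ∃ i, v i = v₀)
    (hV : 0 < V) :
    (∃ S : Finset (Fin n), (∑ i ∈ S, w i) ≤ W ∧ (∑ i ∈ S, v i) = V) ↔
    (∃ choice : Fin n → Bool,
      (if (∑ i, if choice i then w i else 0) ≤ W
        then (n : ℝ) * v₀ - (∑ i, if choice i then v₀ - v i else v₀)
        else 0) = V) := by
  simp only [card_mul_sub_sum_ite]
  constructor
  · rintro ⟨S, hSW, hSV⟩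
    refine ⟨fun i => decide (i ∈ S), ?_⟩
    simp [Finset.sum_ite_mem, hSW, hSV]
  · rintro ⟨choice, h⟩
    split_ifs at h with hW
    · exact ⟨Finset.univ.filter fun i => choice i, by rwa [Finset.sum_filter],
        by rwa [Finset.sum_filter]⟩
    · exact absurd h hV.ne
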